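/- arXiv:2402.14987 — 3 statements merged into one kernel-verified Lean document; each statement's English description precedes it below -/
import Mathlib

section
/- Let (a_t)_{t≥0} be a sequence of real numbers with a_0 = 1 and 0 ≤ a_t ≤ 1 for all t > 0. Then for any ε ∈ (0,1) and any T ∈ ℕ, the set B_T(a,K) satisfies |B_T(a,K)| ≤ ε·T for every K ≥ 2 log(T)/ε. -/
open scoped Classical BigOperators

noncomputable section

/-- `B_T(a, K)`: the set of "surprise" times `1 ≤ s < T` where
`a s ≥ (K/s) · Σ_{u=0}^{s-1} a u`. -/
def surpriseSet (a : ℕ → ℝ) (K : ℝ) (T : ℕ) : Finset ℕ :=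
  (Finset.Ico 1 T).filter fun s => (K / s) * ∑ u ∈ Finset.range s, a u ≤ a s

/-- **Self-bounding lemma.** For any sequence with `a 0 = 1` and `0 ≤ a t ≤ 1` for `t > 0`,
any `ε ∈ (0,1)` and any `T`, the set of surprises satisfies `|B_T(a,K)| ≤ ε T` whenever
`K ≥ 2 log T / ε`. -/
theorem card_surpriseSet_le (a : ℕ → ℝ) (ha0 : a 0 = 1)
    (ha : ∀ t, 0 < t → 0 ≤ a t ∧ a t ≤ 1)
    (ε : ℝ) (hε : ε ∈ Set.Ioo (0 : ℝ) 1) (T : ℕ)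
    (K : ℝ) (hK : 2 * Real.log T / ε ≤ K) :
    ((surpriseSet a K T).card : ℝ) ≤ ε * T := by
  obtain ⟨hε0, hε1⟩ := hε
  rcases Nat.lt_or_ge T 2 with hT | hT
  · have : surpriseSet a K T = ∅ := by
      unfold surpriseSet
      rw [Finset.Ico_eq_empty (by omega)]
      simp
    rw [this]
    simp only [Finset.card_empty, Nat.cast_zero]
    positivity
  have hT2 : (2 : ℝ) ≤ T := by exact_mod_cast hT
  have hTp : (0 : ℝ) < T := by linarith
  have hlog : 0 < Real.log T := Real.log_pos (by linarith)
  have hKp : 0 < K := lt_of_lt_of_le (by positivity) hK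
  have hann : ∀ t, 0 ≤ a t ∧ a t ≤ 1 := by
    intro t
    rcases Nat.eq_zero_or_pos t with h | h
    · subst h; rw [ha0]; norm_num
    · exact ha t h
  have hSle : ∑ u ∈ Finset.range T, a u ≤ T := by
    calc ∑ u ∈ Finset.range T, a u ≤ ∑ u ∈ Finset.range T, (1 : ℝ) :=
          Finset.sum_le_sum fun u _ => (hann u).2
      _ = T := by simp
  have hS1 : ∀ t, 1 ≤ t → 1 ≤ ∑ u ∈ Finset.range t, a u := by
    intro t ht
    rw [← ha0]
    exact Finset.single_le_sum (f := a) (fun u _ => (hann u).1) (Finset.mem_range.2 ht)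
  have key : ∀ t, 1 ≤ t → t ≤ T →
      (1 + K / T) ^ (surpriseSet a K t).card ≤ ∑ u ∈ Finset.range t, a u := by
    intro t ht
    induction t, ht using Nat.le_induction with
    | base => intro _; simp [surpriseSet, ha0]
    | succ t ht ih =>
      intro htT
      have ih := ih (by omega)
      have hS := hS1 t ht
      have htp : (0 : ℝ) < t := by exact_mod_cast ht
      have htT' : (t : ℝ) ≤ T := by exact_mod_cast (by omega : t ≤ T)
      rw [Finset.sum_range_succ]
      have hins : Finset.Ico 1 (t + 1) = insert t (Finset.Ico 1 t) := by
        ext x; simp only [Finset.mem_insert, Finset.mem_Ico]; omega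
      by_cases hc : (K / t) * ∑ u ∈ Finset.range t, a u ≤ a t
      · have hcard : (surpriseSet a K (t + 1)).card = (surpriseSet a K t).card + 1 := by
          unfold surpriseSet
          rw [hins, Finset.filter_insert, if_pos hc, Finset.card_insert_of_notMem (by simp)]
        rw [hcard, pow_succ]
        have h1 : K / T ≤ K / t := by gcongr
        calc (1 + K / T) ^ (surpriseSet a K t).card * (1 + K / T)
            ≤ (∑ u ∈ Finset.range t, a u) * (1 + K / t) := by gcongr
          _ ≤ _ := by linarith
      · have hcard : surpriseSet a K (t + 1) = surpriseSet a K t := by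
          unfold surpriseSet
          rw [hins, Finset.filter_insert, if_neg hc]
        rw [hcard]
        linarith [(hann t).1]
  rcases (surpriseSet a K T).eq_empty_or_nonempty with he | ⟨s, hs⟩
  · rw [he]
    simp only [Finset.card_empty, Nat.cast_zero]
    positivity
  have hKT : K ≤ T := by
    simp only [surpriseSet, Finset.mem_filter, Finset.mem_Ico] at hs
    obtain ⟨⟨h1, h2⟩, h3⟩ := hs
    have hsp : (0 : ℝ) < s := by exact_mod_cast h1
    have hsT : (s : ℝ) ≤ T := by exact_mod_cast h2.le
    have h4 : K / s ≤ 1 := by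
      calc K / s = K / s * 1 := by ring
        _ ≤ K / s * ∑ u ∈ Finset.range s, a u := by gcongr; exact hS1 s h1
        _ ≤ 1 := h3.trans (hann s).2
    rw [div_le_one hsp] at h4
    linarith
  have hpow := (key T (by omega) le_rfl).trans hSle
  have hx0 : 0 < K / T := by positivity
  have hx1 : K / T ≤ 1 := (div_le_one hTp).2 hKT
  have hl := Real.log_le_log (by positivity) hpow
  rw [Real.log_pow] at hl
  have hl2 : K / T / 2 ≤ Real.log (1 + K / T) := by
    refine le_trans ?_ (Real.one_sub_inv_le_log_of_pos (by positivity))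
    have : 1 - (1 + K / T)⁻¹ = K / T / (1 + K / T) := by
      field_simp
      ring
    rw [this]
    gcongr
    linarith
  have h5 : ((surpriseSet a K T).card : ℝ) * (K / T / 2) ≤ Real.log T :=
    le_trans (by gcongr) hl
  rw [div_le_iff₀ hε0] at hK
  have h6 : ((surpriseSet a K T).card : ℝ) * K ≤ (ε * T) * K := by
    have : ((surpriseSet a K T).card : ℝ) * K
        = ((surpriseSet a K T).card : ℝ) * (K / T / 2) * (2 * T) := by
      field_simp
    rw [this]
    calc _ ≤ Real.log T * (2 * T) := by gcongr
      _ = 2 * Real.log T * T := by ring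
      _ ≤ K * ε * T := by gcongr
      _ = _ := by ring
  exact le_of_mul_le_mul_right h6 hKp
end
end

section
/- Let ℱ be a class of functions from 𝒳 to [−1,1], fix points Z_1,…,Z_m ∈ 𝒳, and fix c > 0. Let ε_1,…,ε_m be i.i.d. uniform on {±1}. Then the offset Rademacher complexity satisfies E_ε[ sup_{f∈ℱ} Σ_{i=1}^m ( ε_i f(Z_i) − c·f(Z_i)² ) ] ≤ √(π/2) · (1/(2c)) · log W_m( 2c·ℱ ), where W_m is the Wills functional on the points Z_1,…,Z_m. -/
open MeasureTheory ProbabilityTheory Real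
open scoped ENNReal NNReal BigOperators

noncomputable section

namespace SmoothOnline

variable {𝒳 : Type*}

/-- The Wills functional of a function class `F` on the points `Z 1, …, Z m`:
`W_m(F) = E_ξ[exp(sup_{f ∈ F} Σᵢ (ξᵢ f(Zᵢ) − ½ f(Zᵢ)²))]` with `ξᵢ` i.i.d. standard
Gaussians. -/
def wills (F : Set (𝒳 → ℝ)) {m : ℕ} (Z : Fin m → 𝒳) : ℝ :=
  ∫ ξ : Fin m → ℝ,
    Real.exp (⨆ f : F, ∑ i, (ξ i * f.1 (Z i) - f.1 (Z i) ^ 2 / 2))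
    ∂(Measure.pi fun _ => gaussianReal 0 1)

/-- The scaled class `a·F = {a f : f ∈ F}`. -/
def scale (a : ℝ) (F : Set (𝒳 → ℝ)) : Set (𝒳 → ℝ) := (fun f x => a * f x) '' F

/-- The symmetric Rademacher (sign) distribution on `ℝ`, uniform on `{±1}`. -/
def signMeasure : Measure ℝ := (2 : ℝ≥0∞)⁻¹ • (Measure.dirac (-1) + Measure.dirac 1)

def bb : ℝ := √(2/π)
lemma bb_lt : bb < 1 := by
  unfold bb
  rw [Real.sqrt_lt' one_pos, div_lt_iff₀ Real.pi_pos]; linarith [Real.pi_gt_three]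
lemma bb_gt : 2/3 < bb := by
  unfold bb
  rw [Real.lt_sqrt (by norm_num), lt_div_iff₀ Real.pi_pos]; linarith [Real.pi_lt_four, Real.pi_lt_d2]
lemma kb : √(π/2) * bb = 1 := by
  unfold bb
  rw [← Real.sqrt_mul (by positivity)]
  rw [show π/2*(2/π) = 1 by field_simp]; simp

def pp (x : ℝ) : ℝ := bb * ∫ t in (0:ℝ)..x, exp (-t^2/2)
lemma pp_deriv (x : ℝ) : HasDerivAt pp (bb * exp (-x^2/2)) x := by
  unfold pp
  apply HasDerivAt.const_mul
  have hc : Continuous (fun t : ℝ => exp (-t^2/2)) := by fun_prop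
  exact intervalIntegral.integral_hasDerivAt_right (hc.intervalIntegrable _ _)
    (hc.stronglyMeasurableAtFilter _ _) hc.continuousAt
lemma pp_zero : pp 0 = 0 := by simp [pp]
lemma pp_neg (x : ℝ) : pp (-x) = - pp x := by
  have := intervalIntegral.integral_comp_neg (a := 0) (b := x) (fun t : ℝ => exp (-t^2/2))
  simp only [neg_zero, even_two, Even.neg_pow] at this
  unfold pp
  rw [this, intervalIntegral.integral_symm 0 (-x)]; ring
lemma int_exp : Integrable (fun t : ℝ => exp (-t^2/2)) := by
  have := integrable_exp_neg_mul_sq (b := 1/2) (by norm_num)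
  refine this.congr (ae_of_all _ fun t => ?_)
  simp only; congr 1; ring
lemma int_Ioi : bb * ∫ t in Set.Ioi (0:ℝ), exp (-t^2/2) = 1 := by
  have := integral_gaussian_Ioi (1/2)
  have h2 : (fun t : ℝ => exp (-t^2/2)) = fun t => exp (-(1/2) * t^2) := by
    funext t; congr 1; ring
  rw [h2, this]
  have h3 : √(π / (1/2)) / 2 = √(π/2) := by
    rw [show π / (1/2) = 2^2 * (π/2) by ring, Real.sqrt_mul (by positivity), Real.sqrt_sq (by norm_num)]
    ring
  rw [h3, mul_comm, kb]
lemma pp_tendsto : Filter.Tendsto pp Filter.atTop (nhds 1) := by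
  rw [← int_Ioi]
  exact (intervalIntegral_tendsto_integral_Ioi 0 int_exp.integrableOn Filter.tendsto_id).const_mul bb
lemma pp_mono : StrictMono pp := by
  apply strictMono_of_deriv_pos
  intro x
  rw [(pp_deriv x).deriv]
  have := bb_gt
  have : 0 < bb := by linarith
  positivity
lemma pp_lt (x : ℝ) : pp x < 1 :=
  lt_of_lt_of_le (pp_mono (lt_add_one x)) (pp_mono.monotone.ge_of_tendsto pp_tendsto _)
lemma pp_gt (x : ℝ) : -1 < pp x := by
  have := pp_lt (-x); rw [pp_neg] at this; linarith
lemma pp_nonneg {x : ℝ} (h : 0 ≤ x) : 0 ≤ pp x := by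
  rw [← pp_zero]; exact pp_mono.monotone h

lemma M_nonneg {x : ℝ} (hx : 0 ≤ x) : 0 ≤ exp (-x^2/2) - (1-x)*(1+pp x) := by
  have hd : ∀ x : ℝ, HasDerivAt (fun x => exp (-x^2/2) - (1-x)*(1+pp x))
      (1 + pp x - exp (-x^2/2) * (bb + (1-bb)*x)) x := by
    intro x
    have h1 : HasDerivAt (fun x:ℝ => exp (-x^2/2)) (exp (-x^2/2) * (-x)) x := by
      have : HasDerivAt (fun x:ℝ => -x^2/2) (-x) x := by
        have := ((hasDerivAt_pow 2 x).neg).div_const 2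
        refine this.congr_deriv ?_
        norm_num
        ring
      exact this.exp
    have h2 := (((hasDerivAt_id x).const_sub 1).mul ((pp_deriv x).const_add 1))
    refine (h1.sub h2).congr_deriv ?_
    simp only [id]; ring
  have hm : MonotoneOn (fun x => exp (-x^2/2) - (1-x)*(1+pp x)) (Set.Ici 0) := by
    apply monotoneOn_of_deriv_nonneg (convex_Ici 0)
    · exact fun x _ => (hd x).continuousAt.continuousWithinAt
    · exact fun x _ => (hd x).differentiableAt.differentiableWithinAt
    · intro x hx
      rw [(hd x).deriv]
      simp only [interior_Ici, Set.mem_Ioi] at hx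
      have h1 := pp_nonneg hx.le
      have h2 : exp (-x^2/2) * (1 + x^2/2) ≤ 1 := by
        rw [show -x^2/2 = -(x^2/2) by ring, Real.exp_neg, inv_mul_le_iff₀ (exp_pos _)]
        linarith [Real.add_one_le_exp (x^2/2)]
      have h3 : bb + (1-bb)*x ≤ 1 + x^2/2 := by
        nlinarith [bb_lt, bb_gt, sq_nonneg (x-1), sq_nonneg x]
      have := mul_le_mul_of_nonneg_left h3 (exp_pos (-x^2/2)).le
      linarith
  have := hm (Set.mem_Ici.2 le_rfl) (Set.mem_Ici.2 hx) hx
  simpa [pp_zero] using this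

def kk (s : ℝ) : ℝ := s * exp (-(bb-1/2)*s^2) - pp s
lemma kk_deriv (s : ℝ) : HasDerivAt kk
   (exp (-s^2/2) * ((1 - 2*(bb-1/2)*s^2) * exp ((1-bb)*s^2) - bb)) s := by
  have h1 : HasDerivAt (fun x:ℝ => exp (-(bb-1/2)*x^2)) (exp (-(bb-1/2)*s^2) * (-(bb-1/2)*(2*s))) s := by
    have : HasDerivAt (fun x:ℝ => -(bb-1/2)*x^2) (-(bb-1/2)*(2*s)) s := by
      have := ((hasDerivAt_pow 2 s)).const_mul (-(bb-1/2))
      refine this.congr_deriv ?_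
      simp
    exact this.exp
  refine (((hasDerivAt_id s).mul h1).sub (pp_deriv s)).congr_deriv ?_
  have : exp (-(bb-1/2)*s^2) = exp (-s^2/2) * exp ((1-bb)*s^2) := by
    rw [← Real.exp_add]; congr 1; ring
  rw [this]; simp only [id]; ring
def EE (s : ℝ) : ℝ := 1 - pp s ^2 - exp (-bb*s^2)
lemma EE_deriv (s : ℝ) : HasDerivAt EE (2*bb*exp (-s^2/2) * kk s) s := by
  have h1 : HasDerivAt (fun x:ℝ => exp (-bb*x^2)) (exp (-bb*s^2) * (-bb*(2*s))) s := by
    have : HasDerivAt (fun x:ℝ => -bb*x^2) (-bb*(2*s)) s := by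
      have := ((hasDerivAt_pow 2 s)).const_mul (-bb)
      refine this.congr_deriv ?_
      simp
    exact this.exp
  refine ((((pp_deriv s).pow 2).const_sub 1).sub h1).congr_deriv ?_
  have : exp (-bb*s^2) = exp (-s^2/2) * exp (-(bb-1/2)*s^2) := by
    rw [← Real.exp_add]; congr 1; ring
  rw [this]; unfold kk; norm_num; ring
lemma EE_tendsto : Filter.Tendsto EE Filter.atTop (nhds 0) := by
  have h1 := pp_tendsto.pow 2
  have h2 : Filter.Tendsto (fun s : ℝ => exp (-bb*s^2)) Filter.atTop (nhds 0) := by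
    apply Real.tendsto_exp_atBot.comp
    have : Filter.Tendsto (fun s : ℝ => s^2) Filter.atTop Filter.atTop := Filter.tendsto_pow_atTop (by norm_num)
    exact this.const_mul_atTop_of_neg (by linarith [bb_gt])
  have := (h1.const_sub 1).sub h2
  simp only [one_pow, sub_self] at this
  exact this

def rr (z : ℝ) : ℝ := (1 - 2*(bb-1/2)*z) * exp ((1-bb)*z)
lemma rr_anti : AntitoneOn rr (Set.Ici 0) := by
  have hd : ∀ z, HasDerivAt rr (exp ((1-bb)*z) * ((2-3*bb) - 2*(bb-1/2)*(1-bb)*z)) z := by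
    intro z
    have h1 : HasDerivAt (fun z => exp ((1-bb)*z)) (exp ((1-bb)*z) * (1-bb)) z := by
      have := ((hasDerivAt_id z).const_mul (1-bb)).exp
      simpa using this
    have h2 : HasDerivAt (fun z => 1 - 2*(bb-1/2)*z) (-(2*(bb-1/2))) z := by
      have := ((hasDerivAt_id z).const_mul (2*(bb-1/2))).const_sub 1
      simpa using this
    refine (h2.mul h1).congr_deriv ?_
    ring
  apply antitoneOn_of_deriv_nonpos (convex_Ici 0)
  · exact fun x _ => (hd x).continuousAt.continuousWithinAt
  · exact fun x _ => (hd x).differentiableAt.differentiableWithinAt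
  · intro x hx
    rw [(hd x).deriv]
    simp only [interior_Ici, Set.mem_Ioi] at hx
    apply mul_nonpos_of_nonneg_of_nonpos (exp_pos _).le
    have := bb_gt
    have := bb_lt
    have : 0 ≤ 2*(bb-1/2)*(1-bb)*x := by
      apply mul_nonneg (mul_nonneg _ _) hx.le <;> linarith
    linarith

lemma mvt_neg {f f' : ℝ → ℝ} (hf : ∀ x, HasDerivAt f (f' x) x) (h0 : f 0 = 0) {s : ℝ} (hs : 0 < s)
    (h : f s < 0) : ∃ c, 0 < c ∧ c < s ∧ f' c < 0 := by
  obtain ⟨c, hc, he⟩ := exists_hasDerivAt_eq_slope f f' hs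
    (fun x _ => (hf x).continuousAt.continuousWithinAt) (fun x _ => hf x)
  refine ⟨c, hc.1, hc.2, ?_⟩
  rw [he, h0]
  apply div_neg_of_neg_of_pos <;> linarith
lemma anti_of {f f' : ℝ → ℝ} (hf : ∀ x, HasDerivAt f (f' x) x) {a : ℝ} 
    (h : ∀ x, a ≤ x → f' x ≤ 0) : AntitoneOn f (Set.Ici a) := by
  apply antitoneOn_of_deriv_nonpos (convex_Ici a)
  · exact fun x _ => (hf x).continuousAt.continuousWithinAt
  · exact fun x _ => (hf x).differentiableAt.differentiableWithinAt
  · intro x hx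
    rw [(hf x).deriv]
    exact h x (interior_subset hx)

lemma EE_nonneg {s : ℝ} (hs : 0 ≤ s) : 0 ≤ EE s := by
  rcases hs.eq_or_lt with rfl | hs
  · simp [EE, pp_zero]
  by_contra! hneg
  have hb : 0 < bb := by linarith [bb_gt]
  obtain ⟨s2, h2, h2s, hk⟩ := mvt_neg EE_deriv (by simp [EE, pp_zero]) hs hneg
  have hk : kk s2 < 0 := by
    by_contra! h
    have : 0 ≤ 2*bb*exp (-s2^2/2) * kk s2 := by positivity
    linarith
  obtain ⟨s3, h3, h3s, hk3⟩ := mvt_neg kk_deriv (by simp [kk, pp_zero]) h2 hk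
  have hr : rr (s3^2) < bb := by
    by_contra! h
    have : 0 ≤ exp (-s3^2/2) * (rr (s3^2) - bb) := mul_nonneg (exp_pos _).le (by linarith)
    unfold rr at this; linarith
  have hka : AntitoneOn kk (Set.Ici s3) := by
    apply anti_of kk_deriv
    intro x hx
    have := rr_anti (Set.mem_Ici.2 (sq_nonneg s3)) (Set.mem_Ici.2 (sq_nonneg x))
      (pow_le_pow_left₀ h3.le hx 2)
    apply mul_nonpos_of_nonneg_of_nonpos (exp_pos _).le
    unfold rr at *; linarith
  have hEa : AntitoneOn EE (Set.Ici s) := by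
    apply anti_of EE_deriv
    intro x hx
    have := hka (Set.mem_Ici.2 h3s.le) (Set.mem_Ici.2 (by linarith : s3 ≤ x)) (by linarith)
    apply mul_nonpos_of_nonneg_of_nonpos (by positivity)
    linarith
  have := le_of_tendsto EE_tendsto (Filter.eventually_atTop.2 ⟨s, fun x hx => hEa (Set.mem_Ici.2 le_rfl) hx hx⟩)
  linarith

def gg (x : ℝ) : ℝ := √(π/2) * log (1 + pp x) - x + x^2/2
lemma gg_mono : MonotoneOn gg (Set.Ici 0) := by
  have hd : ∀ x, HasDerivAt gg (exp (-x^2/2) / (1 + pp x) - 1 + x) x := by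
    intro x
    have h0 : (1 + pp x) ≠ 0 := by linarith [pp_gt x]
    have h1 := ((((pp_deriv x).const_add 1).log h0).const_mul √(π/2)).sub (hasDerivAt_id x)
    have h2 := h1.add ((hasDerivAt_pow 2 x).div_const 2)
    refine h2.congr_deriv ?_
    rw [← mul_div_assoc, ← mul_assoc, kb]; norm_num
  apply monotoneOn_of_deriv_nonneg (convex_Ici 0)
  · exact fun x _ => (hd x).continuousAt.continuousWithinAt
  · exact fun x _ => (hd x).differentiableAt.differentiableWithinAt
  · intro x hx
    rw [(hd x).deriv]
    have := M_nonneg (interior_subset hx : 0 ≤ x)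
    have h0 : 0 < (1 + pp x) := by linarith [pp_gt x]
    have : 1 - x ≤ exp (-x^2/2) / (1 + pp x) := by
      rw [le_div_iff₀ h0]; linarith
    linarith
lemma gg_zero : gg 0 = 0 := by simp [gg, pp_zero]
lemma gg_neg_add {s : ℝ} (hs : 0 ≤ s) : 0 ≤ gg s + gg (-s) := by
  have h := EE_nonneg hs
  unfold EE at h
  have h1 : -bb*s^2 ≤ log (1 - pp s^2) := by
    rw [Real.le_log_iff_exp_le]
    · linarith
    · linarith [exp_pos (-bb*s^2)]
  have h2 : log (1 - pp s^2) = log (1 + pp s) + log (1 - pp s) := by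
    rw [← Real.log_mul (by linarith [pp_gt s]) (by linarith [pp_lt s])]; congr 1; ring
  have h3 := mul_le_mul_of_nonneg_left h1 (Real.sqrt_nonneg (π/2))
  have h4 : √(π/2) * (-bb*s^2) = -s^2 := by linear_combination (-s^2) * kb
  unfold gg
  rw [pp_neg, ← sub_eq_add_neg]
  rw [h2] at h3
  linarith
lemma gg_pair {u w : ℝ} (h : 0 ≤ u + w) : 0 ≤ gg u + gg w := by
  wlog hw : w ≤ u generalizing u w
  · rw [add_comm]; exact this (by linarith) (by linarith)
  rcases le_total 0 w with h0 | h0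
  · have := gg_mono (Set.mem_Ici.2 le_rfl) (Set.mem_Ici.2 h0) h0
    have := gg_mono (Set.mem_Ici.2 le_rfl) (Set.mem_Ici.2 (h0.trans hw)) (h0.trans hw)
    rw [gg_zero] at *; linarith
  · have := gg_mono (Set.mem_Ici.2 (by linarith : 0 ≤ -w)) (Set.mem_Ici.2 (by linarith : 0 ≤ u)) (by linarith)
    have := gg_neg_add (by linarith : 0 ≤ -w)
    rw [neg_neg] at this; linarith

def sg (b : Bool) : ℝ := if b then 1 else -1
lemma sg_not (b : Bool) : sg (!b) = - sg b := by cases b <;> simp [sg]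
lemma sg_sq (b : Bool) : sg b * sg b = 1 := by cases b <;> simp [sg]

def ww (b : Bool) (t x : ℝ) : ℝ := if 0 < sg b * x then exp (x * t - t^2/2) else 0
lemma ww_nonneg (b : Bool) (t x : ℝ) : 0 ≤ ww b t x := by
  unfold ww; split_ifs <;> positivity
lemma ww_meas (b : Bool) (t : ℝ) : Measurable (ww b t) := by
  unfold ww
  apply Measurable.ite
  · exact measurableSet_lt measurable_const (by fun_prop)
  · fun_prop
  · fun_prop
lemma ww_int (b : Bool) (t : ℝ) : Integrable (ww b t) (gaussianReal 0 1) := by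
  have h := (integrable_exp_mul_gaussianReal (μ := 0) (v := 1) t).const_mul (exp (-t^2/2))
  refine h.mono' (ww_meas b t).aestronglyMeasurable (ae_of_all _ fun x => ?_)
  rw [Real.norm_of_nonneg (ww_nonneg _ _ _), ← Real.exp_add]
  unfold ww
  split_ifs
  · apply le_of_eq; congr 1; ring
  · positivity
lemma pdf01 (x : ℝ) : gaussianPDFReal 0 1 x = bb / 2 * exp (-x^2/2) := by
  have : (√(2*π))⁻¹ = bb/2 := by
    have h := kb
    have h2 : √(2*π) = 2 * √(π/2) := by
      rw [show 2*π = 2^2 * (π/2) by ring, Real.sqrt_mul (by positivity), Real.sqrt_sq (by norm_num)]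
    rw [h2]
    have : 0 < √(π/2) := by positivity
    field_simp
    linarith
  rw [← this]; simp [gaussianPDFReal]
lemma ww_true (t : ℝ) : ∫ x, gaussianPDFReal 0 1 x • ww true t x = (1 + pp t)/2 := by
  have h1 : (fun x => gaussianPDFReal 0 1 x • ww true t x) =
      fun x => (fun y => (Set.Ioi (-t)).indicator (fun y => bb/2 * exp (-y^2/2)) y) (x - t) := by
    funext x
    simp only [pdf01, ww, sg, if_true, one_mul, Set.indicator, Set.mem_Ioi, smul_eq_mul]
    by_cases hx : 0 < x
    · rw [if_pos hx, if_pos (by linarith), mul_assoc, ← Real.exp_add]; congr 2; ring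
    · rw [if_neg hx, if_neg (by linarith)]; simp
  rw [h1, integral_sub_right_eq_self, integral_indicator measurableSet_Ioi, integral_const_mul,
    ← intervalIntegral.integral_interval_add_Ioi (b := 0) int_exp.integrableOn int_exp.integrableOn]
  have h2 := int_Ioi
  have h3 := pp_neg t
  rw [pp, intervalIntegral.integral_symm] at h3
  linarith
lemma ww_integral (b : Bool) (t : ℝ) :
    ∫ x, ww b t x ∂(gaussianReal 0 1) = (1 + pp (sg b * t))/2 := by
  rw [integral_gaussianReal_eq_integral_smul one_ne_zero]
  cases b
  · rw [← integral_neg_eq_self]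
    have : ∀ x, gaussianPDFReal 0 1 (-x) • ww false t (-x) =
        gaussianPDFReal 0 1 x • ww true (-t) x := by
      intro x; simp [pdf01, ww, sg]
    simp_rw [this]
    rw [ww_true]; simp [sg]
  · rw [ww_true]; simp [sg]

lemma sign_integral {m : ℕ} (h : (Fin m → ℝ) → ℝ) :
    ∫ ε, h ε ∂(Measure.pi fun _ : Fin m => signMeasure) =
      ∑ e : Fin m → Bool, (1/2)^m * h (fun i => sg (e i)) := by
  let ν : Measure Bool := (2 : ℝ≥0∞)⁻¹ • (Measure.dirac false + Measure.dirac true)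
  have : IsFiniteMeasure ν := by
    constructor
    simp [ν, ENNReal.inv_mul_cancel, ENNReal.mul_lt_top_iff]
  have hsg : Measurable sg := measurable_of_finite _
  have h1 : signMeasure = ν.map sg := by
    simp only [ν, signMeasure]
    rw [Measure.map_smul, Measure.map_add _ _ hsg, Measure.map_dirac' hsg, Measure.map_dirac' hsg]
    simp [sg]
  have : IsFiniteMeasure (ν.map sg) := by infer_instance
  have h2 : (Measure.pi fun _ : Fin m => signMeasure) =
      (Measure.pi fun _ : Fin m => ν).map (fun e i => sg (e i)) := by
    rw [h1]
    exact (Measure.pi_map_pi (fun i => hsg.aemeasurable)).symm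
  have hemb : MeasurableEmbedding (fun (e : Fin m → Bool) i => sg (e i)) := by
    refine ⟨?_, measurable_of_finite _, ?_⟩
    · intro a b hab
      funext i
      have h3 : sg (a i) = sg (b i) := congrFun hab i
      have h4 : ∀ p q : Bool, sg p = sg q → p = q := by
        intro p q
        cases p <;> cases q <;> norm_num [sg]
      exact h4 _ _ h3
    · intro s _
      exact (Set.toFinite _).measurableSet
  rw [h2, hemb.integral_map, integral_fintype (Integrable.of_finite)]
  refine Finset.sum_congr rfl fun e _ => ?_
  rw [smul_eq_mul, Measure.real, Measure.pi_singleton]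
  congr 1
  have : ∀ b, ν {b} = 2⁻¹ := by intro b; cases b <;> simp [ν]
  simp [this]

/-- quadratic functional -/
def qq {m : ℕ} (x t : Fin m → ℝ) : ℝ := ∑ i, (x i * t i - t i ^2/2)

lemma core {m : ℕ} (t : (Fin m → Bool) → (Fin m → ℝ))
    (hmax : ∀ e e', qq (fun i => sg (e i)) (t e') ≤ qq (fun i => sg (e i)) (t e)) :
    ∑ e, qq (fun i => sg (e i)) (t e) ≤
      √(π/2) * ∑ e, ∑ i, log (1 + pp (sg (e i) * t e i)) := by
  have key : ∀ i, 0 ≤ ∑ e : Fin m → Bool, gg (sg (e i) * t e i) := by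
    intro i
    let fl : (Fin m → Bool) → (Fin m → Bool) := fun e => Function.update e i (!e i)
    have hfl : Function.Involutive fl := by
      intro e; simp [fl]
    have h1 : ∑ e, gg (sg (fl e i) * t (fl e) i) = ∑ e, gg (sg (e i) * t e i) :=
      Equiv.sum_comp hfl.toPerm (fun e => gg (sg (e i) * t e i))
    have h2 : 0 ≤ ∑ e, (gg (sg (e i) * t e i) + gg (sg (fl e i) * t (fl e) i)) := by
      apply Finset.sum_nonneg
      intro e _
      apply gg_pair
      have ha := hmax e (fl e)
      have hb := hmax (fl e) e
      have hc : ∑ j, (sg (e j) - sg (fl e j)) * (t e j - t (fl e) j) =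
          (qq (fun i => sg (e i)) (t e) - qq (fun i => sg (e i)) (t (fl e))) +
          (qq (fun i => sg (fl e i)) (t (fl e)) - qq (fun i => sg (fl e i)) (t e)) := by
        unfold qq
        simp only [← Finset.sum_sub_distrib, ← Finset.sum_add_distrib]
        refine Finset.sum_congr rfl fun j _ => ?_
        ring
      rw [Finset.sum_eq_single i] at hc
      · have h3 : sg (fl e i) = - sg (e i) := by simp [fl, sg_not]
        rw [h3] at hc ⊢
        linarith
      · intro j _ hj
        simp [fl, Function.update_of_ne hj]
      · simp
    rw [Finset.sum_add_distrib, h1] at h2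
    linarith
  have h := Finset.sum_nonneg (fun i (_ : i ∈ Finset.univ) => key i)
  rw [Finset.sum_comm] at h
  have h4 : ∀ e : Fin m → Bool, ∑ i, gg (sg (e i) * t e i) =
      √(π/2) * ∑ i, log (1 + pp (sg (e i) * t e i)) - qq (fun i => sg (e i)) (t e) := by
    intro e
    unfold qq gg
    rw [Finset.mul_sum, ← Finset.sum_sub_distrib]
    refine Finset.sum_congr rfl fun i _ => ?_
    linear_combination (t e i)^2/2 * sg_sq (e i)
  simp_rw [h4] at h
  rw [Finset.sum_sub_distrib, ← Finset.mul_sum] at h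
  linarith

lemma jensen {m : ℕ} (t : (Fin m → Bool) → (Fin m → ℝ)) {G : (Fin m → ℝ) → ℝ}
    (hG : ∀ x e, qq x (t e) ≤ G x)
    (hint : Integrable (fun x => exp (G x)) (Measure.pi fun _ : Fin m => gaussianReal 0 1)) :
    (1/2)^m * ∑ e, ∑ i, log (1 + pp (sg (e i) * t e i)) ≤
     log (∫ x, exp (G x) ∂(Measure.pi fun _ : Fin m => gaussianReal 0 1)) := by
  have hpos : ∀ e i, 0 < 1 + pp (sg (e i) * t e i) := fun e i => by
    linarith [pp_gt (sg (e i) * t e i)]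
  have h1 : ∀ x : Fin m → ℝ, ∑ e : Fin m → Bool, ∏ i, ww (e i) (t e i) (x i) ≤ exp (G x) := by
    intro x
    rw [Finset.sum_eq_single (fun i => decide (0 < x i))]
    · refine le_trans ?_ (exp_le_exp.2 (hG x (fun i => decide (0 < x i))))
      rw [qq, Real.exp_sum]
      apply Finset.prod_le_prod
      · exact fun _ _ => ww_nonneg _ _ _
      · intro i _
        unfold ww
        split_ifs
        · exact le_rfl
        · positivity
    · intro e _ he
      obtain ⟨i, hi⟩ := Function.ne_iff.1 he
      apply Finset.prod_eq_zero (Finset.mem_univ i)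
      unfold ww
      rw [if_neg]
      intro h
      apply hi
      cases hb : e i
      · simp [hb, sg] at h
        simp; linarith
      · simp [hb, sg] at h
        simp [h]
    · simp
  have hi : ∀ e : Fin m → Bool, Integrable (fun x : Fin m → ℝ => ∏ i, ww (e i) (t e i) (x i))
      (Measure.pi fun _ : Fin m => gaussianReal 0 1) := fun e =>
    Integrable.fintype_prod (f := fun i => ww (e i) (t e i)) (fun i => ww_int _ _)
  have h2 := integral_mono (integrable_finsetSum _ fun e _ => hi e) hint h1
  rw [integral_finsetSum _ fun e _ => hi e] at h2
  have h3 : ∀ e : Fin m → Bool, ∫ x : Fin m → ℝ, ∏ i, ww (e i) (t e i) (x i)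
      ∂(Measure.pi fun _ : Fin m => gaussianReal 0 1) =
      (1/2)^m * ∏ i, (1 + pp (sg (e i) * t e i)) := by
    intro e
    rw [integral_fintype_prod_eq_prod (fun i => ww (e i) (t e i))]
    simp_rw [ww_integral, div_eq_mul_inv]
    rw [Finset.prod_mul_distrib]
    simp [mul_comm]
  simp_rw [h3] at h2
  have hp2 : ∀ e : Fin m → Bool, 0 < ∏ i, (1 + pp (sg (e i) * t e i)) :=
    fun e => Finset.prod_pos fun i _ => hpos e i
  have h4 := (strictConcaveOn_log_Ioi.concaveOn).le_map_sum (t := Finset.univ)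
    (w := fun _ : Fin m → Bool => ((1:ℝ)/2)^m) (p := fun e => ∏ i, (1 + pp (sg (e i) * t e i)))
    (fun _ _ => by positivity) (by simp [← mul_pow]) (fun e _ => hp2 e)
  simp only [smul_eq_mul] at h4
  have h5 : 0 < ∑ e : Fin m → Bool, ((1:ℝ)/2)^m * ∏ i, (1 + pp (sg (e i) * t e i)) :=
    Finset.sum_pos (fun e _ => mul_pos (by positivity) (hp2 e)) Finset.univ_nonempty
  refine le_trans ?_ (h4.trans (Real.log_le_log h5 h2))
  rw [Finset.mul_sum]
  refine Finset.sum_le_sum fun e _ => ?_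
  rw [Real.log_prod (fun i _ => (hpos e i).ne')]

lemma expabs_int {m : ℕ} (M : ℝ) : Integrable (fun x : Fin m → ℝ => exp (∑ i, M * |x i|))
    (Measure.pi fun _ : Fin m => gaussianReal 0 1) := by
  simp_rw [Real.exp_sum]
  refine Integrable.fintype_prod (f := fun _ x => exp (M * |x|)) (fun i => ?_)
  have h := (integrable_exp_mul_gaussianReal (μ := 0) (v := 1) M).add
    (integrable_exp_mul_gaussianReal (μ := 0) (v := 1) (-M))
  refine h.mono' (by fun_prop) (ae_of_all _ fun x => ?_)
  rw [Real.norm_of_nonneg (exp_pos _).le]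
  simp only [Pi.add_apply]
  have h1 := exp_pos (M*x)
  have h2 := exp_pos (-M*x)
  rcases abs_cases x with ⟨h, _⟩ | ⟨h, _⟩ <;> rw [h]
  · linarith
  · rw [show M * -x = -M*x by ring]; linarith

/-- **Offset Rademacher complexity is controlled by the Wills functional:**
`E_ε[sup_{f∈F} Σᵢ (εᵢ f(Zᵢ) − c f(Zᵢ)²)] ≤ √(π/2) (2c)⁻¹ log W_m(2c·F)`. -/
theorem offset_rademacher_le_wills (F : Set (𝒳 → ℝ)) (hF : F.Nonempty)
    (hFbdd : ∀ f ∈ F, ∀ x, f x ∈ Set.Icc (-1 : ℝ) 1)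
    (m : ℕ) (Z : Fin m → 𝒳) (c : ℝ) (hc : 0 < c) :
    (∫ ε : Fin m → ℝ, (⨆ f : F, ∑ i, (ε i * f.1 (Z i) - c * f.1 (Z i) ^ 2))
        ∂(Measure.pi fun _ => signMeasure)) ≤
      Real.sqrt (π / 2) * (1 / (2 * c)) * Real.log (wills (scale (2 * c) F) Z) := by
  classical
  set T : Set (Fin m → ℝ) := (fun f : 𝒳 → ℝ => fun i => 2 * c * f (Z i)) '' F with hT
  have hTne : T.Nonempty := hF.image _
  have hTb : ∀ t ∈ T, ∀ i, |t i| ≤ 2 * c := by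
    rintro _ ⟨f, hf, rfl⟩ i
    have := hFbdd f hf (Z i)
    have h1 : |f (Z i)| ≤ 1 := abs_le.2 this
    simp only [abs_mul, abs_of_pos hc, abs_two]
    nlinarith
  have hqb : ∀ x, ∀ t ∈ T, qq x t ≤ ∑ i, (2 * c) * |x i| := by
    intro x t ht
    refine Finset.sum_le_sum fun i _ => ?_
    have h1 := hTb t ht i
    have h2 : x i * t i ≤ |x i| * |t i| := by rw [← abs_mul]; exact le_abs_self _
    have h3 := mul_le_mul_of_nonneg_left h1 (abs_nonneg (x i))
    nlinarith [sq_nonneg (t i)]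
  have hK : IsCompact (closure T) := by
    refine Bornology.IsBounded.isCompact_closure ?_
    refine (Metric.isBounded_closedBall (x := (0 : Fin m → ℝ)) (r := 2 * c)).subset ?_
    intro t ht
    rw [mem_closedBall_zero_iff, pi_norm_le_iff_of_nonneg (by positivity)]
    exact fun i => hTb t ht i
  have hcont : ∀ x : Fin m → ℝ, Continuous (fun t => qq x t) := by
    intro x; unfold qq; fun_prop
  have hex : ∀ e : Fin m → Bool, ∃ t ∈ closure T, ∀ t' ∈ closure T,
      qq (fun i => sg (e i)) t' ≤ qq (fun i => sg (e i)) t := by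
    intro e
    obtain ⟨t, ht, h⟩ := hK.exists_isMaxOn hTne.closure (hcont fun i => sg (e i)).continuousOn
    exact ⟨t, ht, fun t' ht' => h ht'⟩
  choose t htK htmax using hex
  have hcore := core t (fun e e' => htmax e _ (htK e'))
  -- Wills side
  let G : (Fin m → ℝ) → ℝ := fun x =>
    ⨆ f : scale (2 * c) F, ∑ i, (x i * f.1 (Z i) - f.1 (Z i) ^ 2 / 2)
  have hmem : ∀ f : scale (2 * c) F, (fun i => f.1 (Z i)) ∈ T := by
    rintro ⟨_, f, hf, rfl⟩
    exact ⟨f, hf, rfl⟩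
  have hbdd : ∀ x : Fin m → ℝ, BddAbove (Set.range fun f : scale (2 * c) F =>
      ∑ i, (x i * f.1 (Z i) - f.1 (Z i) ^ 2 / 2)) := by
    intro x
    refine ⟨∑ i, (2 * c) * |x i|, ?_⟩
    rintro _ ⟨f, rfl⟩
    exact hqb x _ (hmem f)
  have hGT : ∀ x, ∀ t ∈ T, qq x t ≤ G x := by
    rintro x _ ⟨f, hf, rfl⟩
    exact le_ciSup (hbdd x) ⟨fun y => 2 * c * f y, f, hf, rfl⟩
  have hGK : ∀ x, ∀ t ∈ closure T, qq x t ≤ G x := by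
    intro x t ht
    exact closure_minimal (s := T) (t := {t | qq x t ≤ G x}) (hGT x)
      (isClosed_le (hcont x) continuous_const) ht
  have : Nonempty (scale (2 * c) F) := (hF.image _).to_subtype
  have : Nonempty F := hF.to_subtype
  have hGm : Measurable G := by
    apply LowerSemicontinuous.measurable
    apply lowerSemicontinuous_ciSup hbdd
    intro f
    apply Continuous.lowerSemicontinuous
    fun_prop
  have hint : Integrable (fun x => exp (G x)) (Measure.pi fun _ : Fin m => gaussianReal 0 1) := by
    refine (expabs_int (m := m) (2 * c)).mono' (by fun_prop) (ae_of_all _ fun x => ?_)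
    rw [Real.norm_of_nonneg (exp_pos _).le]
    exact exp_le_exp.2 (ciSup_le fun f => hqb x _ (hmem f))
  have hj := jensen t (fun x e => hGK x _ (htK e)) hint
  change _ ≤ log (wills (scale (2 * c) F) Z) at hj
  -- Rademacher side
  rw [sign_integral]
  have hL : ∀ e : Fin m → Bool, (⨆ f : F, ∑ i, (sg (e i) * f.1 (Z i) - c * f.1 (Z i) ^ 2)) ≤
      1 / (2 * c) * qq (fun i => sg (e i)) (t e) := by
    intro e
    refine ciSup_le fun f => ?_
    have h := htmax e _ (subset_closure ⟨f.1, f.2, rfl⟩)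
    refine le_trans (le_of_eq ?_) (mul_le_mul_of_nonneg_left h (by positivity))
    unfold qq
    rw [Finset.mul_sum]
    refine Finset.sum_congr rfl fun i _ => ?_
    field_simp
  calc _ ≤ ∑ e : Fin m → Bool, (1/2)^m * (1 / (2 * c) * qq (fun i => sg (e i)) (t e)) :=
        Finset.sum_le_sum fun e _ => mul_le_mul_of_nonneg_left (hL e) (by positivity)
    _ = 1 / (2 * c) * ((1/2)^m * ∑ e : Fin m → Bool, qq (fun i => sg (e i)) (t e)) := by
        simp only [Finset.mul_sum]
        refine Finset.sum_congr rfl fun e _ => ?_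
        ring
    _ ≤ 1 / (2 * c) * ((1/2)^m * (√(π/2) * ∑ e, ∑ i, log (1 + pp (sg (e i) * t e i)))) := by
        gcongr
    _ = √(π/2) * (1 / (2 * c)) * ((1/2)^m * ∑ e, ∑ i, log (1 + pp (sg (e i) * t e i))) := by ring
    _ ≤ _ := by gcongr

end SmoothOnline
end
end

section
/- Let (a_t)_{t≥0} be a sequence with a_0 = 1 and 0 ≤ a_t ≤ 1 for all t > 0, fix K > 0 and T ∈ ℕ, and write B_T(a,K) = {t_1 < t_2 < … < t_i}. Define a new sequence (b_t)_{t≥0} by b_0 = 1, b_{t_1} = a_{t_1}, b_t = 0 for every t > 0 with t ∉ B_T(a,K), and b_{t_j} = (K/t_j)·Σ_{s=0}^{t_j−1} b_s for 2 ≤ j ≤ i. Then B_T(b,K) ⊇ B_T(a,K), so |B_T(b,K)| ≥ |B_T(a,K)|, and moreover 0 ≤ b_t ≤ a_t ≤ 1 for all 1 ≤ t ≤ T. -/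
open scoped Classical BigOperators

noncomputable section

/-- The modified sequence `b` (vanishing off `B_T(a,K)`, equal to `a` at the first
surprise time `t₁ = min B_T(a,K)`, and saturating the surprise inequality at the
later surprise times) has at least as many surprises as `a`, and satisfies
`0 ≤ b t ≤ a t ≤ 1` for all `1 ≤ t ≤ T`. -/
theorem surpriseSet_modified_sequence (a : ℕ → ℝ) (ha0 : a 0 = 1)
    (ha : ∀ t, 0 < t → 0 ≤ a t ∧ a t ≤ 1)
    (K : ℝ) (hK : 0 < K) (T : ℕ)
    (b : ℕ → ℝ) (hb0 : b 0 = 1)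
    (hbmin : ∀ h : (surpriseSet a K T).Nonempty,
      b ((surpriseSet a K T).min' h) = a ((surpriseSet a K T).min' h))
    (hbzero : ∀ t, 0 < t → t ∉ surpriseSet a K T → b t = 0)
    (hbrec : ∀ t ∈ surpriseSet a K T,
      (∀ h : (surpriseSet a K T).Nonempty, t ≠ (surpriseSet a K T).min' h) →
      b t = (K / t) * ∑ s ∈ Finset.range t, b s) :
    surpriseSet a K T ⊆ surpriseSet b K T ∧
    (surpriseSet a K T).card ≤ (surpriseSet b K T).card ∧
    ∀ t, 1 ≤ t → t ≤ T → 0 ≤ b t ∧ b t ≤ a t ∧ a t ≤ 1 := by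
  have key : ∀ t, 0 ≤ b t ∧ b t ≤ a t := by
    intro t
    induction t using Nat.strong_induction_on with
    | _ t ih =>
      rcases Nat.eq_zero_or_pos t with h0 | hpos
      · subst h0
        rw [hb0, ha0]
        norm_num
      · by_cases hm : t ∈ surpriseSet a K T
        · by_cases hmin : ∀ h : (surpriseSet a K T).Nonempty, t ≠ (surpriseSet a K T).min' h
          · have hc : 0 ≤ K / (t : ℝ) := by positivity
            have hmem := (Finset.mem_filter.mp hm).2
            rw [hbrec t hm hmin]
            refine ⟨mul_nonneg hc (Finset.sum_nonneg fun s hs =>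
              (ih s (Finset.mem_range.mp hs)).1), le_trans ?_ hmem⟩
            exact mul_le_mul_of_nonneg_left (Finset.sum_le_sum fun s hs =>
              (ih s (Finset.mem_range.mp hs)).2) hc
          · push Not at hmin
            obtain ⟨h, he⟩ := hmin
            have := hbmin h
            rw [← he] at this
            rw [this]
            exact ⟨(ha t hpos).1, le_refl _⟩
        · rw [hbzero t hpos hm]
          exact ⟨le_refl _, (ha t hpos).1⟩
  have hsub : surpriseSet a K T ⊆ surpriseSet b K T := by
    intro t hm
    have hmem := Finset.mem_filter.mp hm
    refine Finset.mem_filter.mpr ⟨hmem.1, ?_⟩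
    by_cases hmin : ∀ h : (surpriseSet a K T).Nonempty, t ≠ (surpriseSet a K T).min' h
    · exact (hbrec t hm hmin).ge
    · push Not at hmin
      obtain ⟨h, he⟩ := hmin
      have hbt := hbmin h
      rw [← he] at hbt
      rw [hbt]
      refine le_trans ?_ hmem.2
      have hc : 0 ≤ K / (t : ℝ) := by positivity
      exact mul_le_mul_of_nonneg_left (Finset.sum_le_sum fun s _ => (key s).2) hc
  exact ⟨hsub, Finset.card_le_card hsub, fun t h1 _ => ⟨(key t).1, (key t).2, (ha t h1).2⟩⟩
end
end
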